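/- arXiv:2501.10043 — 2 statements merged into one kernel-verified Lean document; each statement's English description precedes it below -/
import Mathlib

section
/- (Corollary 2.2, degree of P_2.) For all integers m, n ≥ 2, every integer ξ with 1 ≤ ξ ≤ n and every integer ρ with 1 ≤ ρ ≤ m, there exists a polynomial p ∈ ℚ[r] such that P_2(m,n,ρ,ξ,r) = p(r) for all sufficiently large natural numbers r, and the degree of p equals 2m+2n−5 if ξ = 1 and ρ = m, and equals m+2n+ρ−ξ−3 if ξ > 1 or ρ < m. -/
/-- A multiset of pairs of positive integers contains a 2-chain:
two elements (at distinct positions) with both coordinates strictly increasing. -/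
def Has2Chain (S : Multiset (ℕ × ℕ)) : Prop :=
  ∃ a ∈ S, ∃ b ∈ S, a.1 < b.1 ∧ a.2 < b.2

/-- A multiset of pairs contains a 3-chain:
three elements with both coordinates strictly increasing. -/
def Has3Chain (S : Multiset (ℕ × ℕ)) : Prop :=
  ∃ a ∈ S, ∃ b ∈ S, ∃ c ∈ S, a.1 < b.1 ∧ b.1 < c.1 ∧ a.2 < b.2 ∧ b.2 < c.2

/-- The index multiset of a degree-`r` monomial in the variables `z_{i,j}`,
`1 ≤ i ≤ m`, `1 ≤ j ≤ n`, with 1-indexed entries. -/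
def idxMS (m n r : ℕ) (f : Sym (Fin m × Fin n) r) : Multiset (ℕ × ℕ) :=
  Multiset.map (fun p => (p.1.1 + 1, p.2.1 + 1)) (f : Multiset (Fin m × Fin n))

/-- `P1 m n ξ r`: number of degree-`r` monomials in the `m × n` grid of variables
whose index multiset contains no 3-chain and whose part with column index `< ξ`
contains no 2-chain. -/
noncomputable def P1 (m n ξ r : ℕ) : ℕ :=
  Nat.card {f : Sym (Fin m × Fin n) r //
    ¬ Has3Chain (idxMS m n r f) ∧
    ¬ Has2Chain ((idxMS m n r f).filter (fun p => p.2 < ξ)) }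

/-- `h3 m n r`: number of degree-`r` monomials whose index multiset contains no 3-chain. -/
noncomputable def h3 (m n r : ℕ) : ℕ :=
  Nat.card {f : Sym (Fin m × Fin n) r // ¬ Has3Chain (idxMS m n r f) }

/-- `P2 m n ρ ξ r`: number of degree-`r` monomials `f` such that every `(i,j)` in the
index multiset satisfies `i ≤ ρ` or `j ≥ ξ`, the index multiset contains no 3-chain, and
neither the part with `j < ξ` nor the part with `i > ρ` contains a 2-chain. -/
noncomputable def P2 (m n ρ ξ r : ℕ) : ℕ :=
  Nat.card {f : Sym (Fin m × Fin n) r //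
    (∀ p ∈ idxMS m n r f, p.1 ≤ ρ ∨ ξ ≤ p.2) ∧
    ¬ Has3Chain (idxMS m n r f) ∧
    ¬ Has2Chain ((idxMS m n r f).filter (fun p => p.2 < ξ)) ∧
    ¬ Has2Chain ((idxMS m n r f).filter (fun p => ρ < p.1)) }

open Finset in
/-- The multisets of size `r` with support exactly `F` are counted by `multichoose`. -/
theorem card_sym_toFinset_eq {α : Type*} [Fintype α] [DecidableEq α] (F : Finset α) (r : ℕ)
    (hr : #F ≤ r) :
    #{f : Sym α r | (f : Multiset α).toFinset = F} = (#F).multichoose (r - #F) := by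
  have hcard := Sym.card_sym_eq_multichoose F (r - #F)
  rw [Fintype.card_coe] at hcard
  rw [← hcard, ← Finset.card_univ]
  symm
  refine Finset.card_bij
    (fun g _ => Sym.mk ((g : Multiset F).map Subtype.val + F.val) (by simp [hr])) ?_ ?_ ?_
  · intro g _
    rw [mem_filter]
    refine ⟨mem_univ _, ?_⟩
    ext x
    simp only [Sym.coe_mk, Multiset.toFinset_add, mem_union, Multiset.mem_toFinset, Multiset.mem_map,
      Finset.mem_val, or_iff_right_iff_imp]
    rintro ⟨y, _, rfl⟩
    exact y.2
  · intro g _ h _ hgh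
    have := congrArg Subtype.val hgh
    simp only [add_left_inj] at this
    exact Sym.coe_injective (Multiset.map_injective Subtype.val_injective this)
  · intro f hf
    simp only [mem_filter, mem_univ, true_and] at hf
    have hle : F.val ≤ (f : Multiset α) := by
      rw [← hf]
      exact Multiset.dedup_le _
    have hmem : ∀ x ∈ (f : Multiset α) - F.val, x ∈ F := fun x hx => by
      rw [← hf, Multiset.mem_toFinset]
      exact Multiset.mem_of_le (Multiset.sub_le_self _ _) hx
    refine ⟨Sym.mk (((f : Multiset α) - F.val).pmap Subtype.mk hmem) ?_, mem_univ _, ?_⟩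
    · simp [Multiset.card_sub hle]
    · apply Sym.coe_injective
      simp [Multiset.map_pmap, Multiset.pmap_eq_map, Multiset.sub_add_cancel hle]

open Finset Polynomial in
/-- The number of multisets of size `r` whose support lies in `Δ` is eventually polynomial in `r`,
of degree one less than the largest cardinality of a member of `Δ`. -/
theorem exists_polynomial_card_sym {α : Type*} [Fintype α] [DecidableEq α]
    (Δ : Finset (Finset α)) (d : ℕ) (hle : ∀ F ∈ Δ, #F ≤ d + 1) (hex : ∃ F ∈ Δ, #F = d + 1) :
    ∃ p : ℚ[X],
      (∀ᶠ r in Filter.atTop,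
        (#{f : Sym α r | (f : Multiset α).toFinset ∈ Δ} : ℚ) = p.eval (r : ℚ)) ∧
      p.natDegree = d := by
  refine ⟨∑ F ∈ Δ with F.Nonempty, preHilbertPoly ℚ (#F - 1) #F, ?_, ?_⟩
  · filter_upwards [Filter.eventually_ge_atTop (d + 1)] with r hr
    have hfib := Finset.card_eq_sum_card_fiberwise
      (s := univ.filter fun f : Sym α r => (f : Multiset α).toFinset ∈ Δ) (t := Δ)
      (f := fun f : Sym α r => (f : Multiset α).toFinset) (fun f hf => (mem_filter.1 hf).2)
    rw [hfib, eval_finsetSum, Nat.cast_sum, Finset.sum_filter]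
    refine Finset.sum_congr rfl fun F hF => ?_
    have hFr : #F ≤ r := (hle F hF).trans hr
    have hfilter : (univ.filter fun f : Sym α r => (f : Multiset α).toFinset ∈ Δ).filter
        (fun f : Sym α r => (f : Multiset α).toFinset = F) =
        univ.filter fun f : Sym α r => (f : Multiset α).toFinset = F := by
      ext f
      simp only [mem_filter, mem_univ, true_and, and_iff_right_iff_imp]
      rintro rfl
      exact hF
    rw [hfilter, card_sym_toFinset_eq F r hFr]
    split_ifs with hne
    · rw [preHilbertPoly_eq_choose_sub_add ℚ _ hFr, Nat.multichoose_eq]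
      have := hne.card_pos
      rw [show #F + (r - #F) - 1 = (r - #F) + (#F - 1) by omega, Nat.choose_symm_add]
    · rw [Finset.not_nonempty_iff_eq_empty] at hne
      subst hne
      obtain ⟨k, hk⟩ : ∃ k, r = k + 1 := ⟨r - 1, by omega⟩
      simp [hk]
  · apply natDegree_eq_of_le_of_coeff_ne_zero
    · refine natDegree_sum_le_of_forall_le _ _ fun F hF => ?_
      rw [natDegree_preHilbertPoly]
      have := hle F (mem_filter.1 hF).1
      omega
    · rw [finsetSum_coeff]
      apply ne_of_gt
      obtain ⟨F, hF, hFd⟩ := hex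
      refine Finset.sum_pos' (fun G hG => ?_) ⟨F, ?_, ?_⟩
      · have hGd := hle G (mem_filter.1 hG).1
        rcases Nat.lt_or_ge (#G - 1) d with h | h
        · rw [coeff_eq_zero_of_natDegree_lt (by rwa [natDegree_preHilbertPoly])]
        · rw [show d = #G - 1 by omega, coeff_preHilbertPoly_self]
          positivity
      · exact mem_filter.2 ⟨hF, card_pos.1 (by omega)⟩
      · rw [show d = #F - 1 by omega, coeff_preHilbertPoly_self]
        positivity

open Finset in
/-- A set without 2-chains meets every diagonal at most once. -/
theorem card_le_of_no_chain {m n : ℕ} (A : Finset (Fin m × Fin n)) (lo hi : ℤ)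
    (hA : ∀ a ∈ A, ∀ b ∈ A, ¬ (a.1 < b.1 ∧ a.2 < b.2))
    (hlo : ∀ a ∈ A, lo ≤ (a.2 : ℤ) - (a.1 : ℤ)) (hhi : ∀ a ∈ A, (a.2 : ℤ) - (a.1 : ℤ) ≤ hi) :
    #A ≤ (hi + 1 - lo).toNat := by
  rw [← Int.card_Icc]
  refine Finset.card_le_card_of_injOn (fun a => (a.2 : ℤ) - (a.1 : ℤ))
    (fun a ha => Finset.mem_coe.2 (mem_Icc.2 ⟨hlo a ha, hhi a ha⟩)) fun a ha b hb hab => ?_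
  have h₁ := hA a ha b hb
  have h₂ := hA b hb a ha
  simp only [Fin.lt_def] at h₁ h₂ hab
  ext <;> omega

/-- The supports counted by `P2`, in 0-indexed coordinates. -/
def IsP2Support {m n : ℕ} (ρ ξ : ℕ) (F : Finset (Fin m × Fin n)) : Prop :=
  (∀ a ∈ F, a.1.1 < ρ ∨ ξ ≤ a.2.1 + 1) ∧
  (∀ a ∈ F, ∀ b ∈ F, ∀ c ∈ F, a.1 < b.1 → b.1 < c.1 → a.2 < b.2 → ¬ b.2 < c.2) ∧
  (∀ a ∈ F, ∀ b ∈ F, a.2.1 + 1 < ξ → b.2.1 + 1 < ξ → ¬ (a.1 < b.1 ∧ a.2 < b.2)) ∧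
  (∀ a ∈ F, ∀ b ∈ F, ρ ≤ a.1.1 → ρ ≤ b.1.1 → ¬ (a.1 < b.1 ∧ a.2 < b.2))

open Classical Finset in
theorem P2_eq_card (m n ρ ξ r : ℕ) :
    P2 m n ρ ξ r = #{f : Sym (Fin m × Fin n) r |
      (f : Multiset (Fin m × Fin n)).toFinset ∈
        ({F | IsP2Support ρ ξ F} : Finset (Finset (Fin m × Fin n)))} := by
  rw [P2, Nat.card_eq_fintype_card, Fintype.card_subtype]
  refine congrArg Finset.card (Finset.filter_congr fun f _ => ?_)
  rw [mem_filter, and_iff_right (mem_univ _)]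
  simp only [IsP2Support, Multiset.mem_toFinset, idxMS,
    Has3Chain, Has2Chain, Multiset.mem_filter, Multiset.mem_map]
  refine and_congr ?_ (and_congr ?_ (and_congr ?_ ?_))
  · constructor
    · intro h a ha
      have := h _ ⟨a, ha, rfl⟩
      simp only at this
      omega
    · rintro h _ ⟨a, ha, rfl⟩
      have := h a ha
      simp only
      omega
  · constructor
    · intro h a ha b hb c hc h₁ h₂ h₃ h₄
      refine h ⟨_, ⟨a, ha, rfl⟩, _, ⟨b, hb, rfl⟩, _, ⟨c, hc, rfl⟩, ?_⟩
      simp only [Fin.lt_def] at *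
      omega
    · rintro h ⟨_, ⟨a, ha, rfl⟩, _, ⟨b, hb, rfl⟩, _, ⟨c, hc, rfl⟩, h'⟩
      have := h a ha b hb c hc
      simp only [Fin.lt_def] at *
      omega
  · constructor
    · intro h a ha b hb h₁ h₂ h₃
      refine h ⟨_, ⟨⟨a, ha, rfl⟩, h₁⟩, _, ⟨⟨b, hb, rfl⟩, h₂⟩, ?_⟩
      simp only [Fin.lt_def] at *
      omega
    · rintro h ⟨_, ⟨⟨a, ha, rfl⟩, h₁⟩, _, ⟨⟨b, hb, rfl⟩, h₂⟩, h'⟩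
      have := h a ha b hb
      simp only [Fin.lt_def] at *
      omega
  · constructor
    · intro h a ha b hb h₁ h₂ h₃
      refine h ⟨_, ⟨⟨a, ha, rfl⟩, by simp only; omega⟩, _, ⟨⟨b, hb, rfl⟩, by simp only; omega⟩, ?_⟩
      simp only [Fin.lt_def] at *
      omega
    · rintro h ⟨_, ⟨⟨a, ha, rfl⟩, h₁⟩, _, ⟨⟨b, hb, rfl⟩, h₂⟩, h'⟩
      have := h a ha b hb
      simp only [Fin.lt_def] at *
      omega

open Classical Finset in
/-- A support splits into two parts without 2-chains, the first avoiding the rows from `ρ` on and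
the second avoiding the first `ξ - 1` columns: the second part consists of the elements in the rows
from `ρ` on and of the non-minimal elements. -/
theorem IsP2Support.exists_partition {m n ρ ξ : ℕ} {F : Finset (Fin m × Fin n)}
    (hF : IsP2Support ρ ξ F) :
    ∃ A B : Finset (Fin m × Fin n), F = A ∪ B ∧
      (∀ a ∈ A, ∀ b ∈ A, ¬ (a.1 < b.1 ∧ a.2 < b.2)) ∧
      (∀ a ∈ B, ∀ b ∈ B, ¬ (a.1 < b.1 ∧ a.2 < b.2)) ∧
      (∀ a ∈ A, a.1.1 < ρ) ∧ (∀ b ∈ B, ξ ≤ b.2.1 + 1) := by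
  obtain ⟨h₁, h₃, hξ, hρ⟩ := hF
  let p : Fin m × Fin n → Prop := fun b => ρ ≤ b.1.1 ∨ ∃ a ∈ F, a.1 < b.1 ∧ a.2 < b.2
  refine ⟨F.filter fun b => ¬ p b, F.filter p, ?_, ?_, ?_, ?_, ?_⟩
  · rw [Finset.union_comm, Finset.filter_union_filter_not_eq]
  · intro a ha b hb hab
    exact (mem_filter.1 hb).2 (Or.inr ⟨a, (mem_filter.1 ha).1, hab⟩)
  · intro a ha b hb hab
    rw [mem_filter] at ha hb
    rcases ha.2 with h | ⟨c, hc, hca⟩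
    · exact hρ a ha.1 b hb.1 h (h.trans (Fin.lt_def.1 hab.1).le) hab
    · exact h₃ c hc a ha.1 b hb.1 hca.1 hab.1 hca.2 hab.2
  · intro a ha
    by_contra h
    exact (mem_filter.1 ha).2 (Or.inl (not_lt.1 h))
  · intro b hb
    rw [mem_filter] at hb
    rcases hb.2 with h | ⟨a, ha, hab⟩
    · have := h₁ b hb.1
      omega
    · by_contra h
      have := Fin.lt_def.1 hab.2
      exact hξ a ha b hb.1 (by omega) (by omega) hab

open Finset in
theorem IsP2Support.card_le {m n ρ ξ : ℕ} {F : Finset (Fin m × Fin n)}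
    (hm : 2 ≤ m) (hn : 2 ≤ n) (hρ1 : 1 ≤ ρ) (hξ1 : 1 ≤ ξ) (hξn : ξ ≤ n)
    (hF : IsP2Support ρ ξ F) :
    #F ≤ if ξ = 1 ∧ ρ = m then 2 * m + 2 * n - 4 else m + 2 * n + ρ - ξ - 2 := by
  classical
  obtain ⟨A, B, rfl, hA, hB, hAρ, hBξ⟩ := hF.exists_partition
  let p : Fin m × Fin n := (⟨0, by omega⟩, ⟨n - 1, by omega⟩)
  let q : Fin m × Fin n := (⟨m - 1, by omega⟩, ⟨0, by omega⟩)
  have hne : ∀ a ≠ p, (a.2 : ℤ) - (a.1 : ℤ) ≤ n - 2 := by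
    intro a ha
    by_contra h
    exact ha (by ext <;> simp [p] <;> omega)
  have hne' : ∀ a ≠ q, (2 : ℤ) - m ≤ (a.2 : ℤ) - (a.1 : ℤ) := by
    intro a ha
    by_contra h
    exact ha (by ext <;> simp [q] <;> omega)
  split_ifs with h
  · have key : ∀ C : Finset (Fin m × Fin n), (∀ a ∈ C, ∀ b ∈ C, ¬ (a.1 < b.1 ∧ a.2 < b.2)) →
        #((C.erase p).erase q) ≤ ((n - 2 : ℤ) + 1 - (2 - m)).toNat := fun C hC => by
      refine card_le_of_no_chain _ _ _ ?_ (fun a ha => hne' a (by simp_all))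
        (fun a ha => hne a (by simp_all))
      intro a ha b hb
      exact hC a (by simp_all) b (by simp_all)
    have hA' := key A hA
    have hB' := key B hB
    have h₁ : #(A ∪ B) ≤ #((A.erase p).erase q) + #((B.erase p).erase q) + 2 := by
      have hu : A ∪ B ⊆ ((A.erase p).erase q ∪ (B.erase p).erase q) ∪ {p, q} := by
        intro x
        simp only [mem_union, mem_erase, mem_insert, mem_singleton]
        tauto
      exact (Finset.card_le_card hu).trans ((card_union_le _ _).trans
        (add_le_add (card_union_le _ _) Finset.card_le_two))
    omega
  · have hA' := card_le_of_no_chain (A.erase p) (1 - ρ) (n - 2)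
      (fun a ha b hb => hA a (mem_of_mem_erase ha) b (mem_of_mem_erase hb))
      (fun a ha => by have := hAρ a (mem_of_mem_erase ha); omega)
      (fun a ha => hne a (ne_of_mem_erase ha))
    have hB' := card_le_of_no_chain (B.erase p) (ξ - m) (n - 2)
      (fun a ha b hb => hB a (mem_of_mem_erase ha) b (mem_of_mem_erase hb))
      (fun a ha => by have := hBξ a (mem_of_mem_erase ha); omega)
      (fun a ha => hne a (ne_of_mem_erase ha))
    have h₁ : #(A ∪ B) ≤ #(A.erase p) + #(B.erase p) + 1 := by
      have hu : A ∪ B ⊆ (A.erase p ∪ B.erase p) ∪ {p} := by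
        intro x
        simp only [mem_union, mem_erase, mem_singleton]
        tauto
      exact (Finset.card_le_card hu).trans ((card_union_le _ _).trans
        (add_le_add (card_union_le _ _) (card_singleton _).le))
    omega

open Finset in
/-- A support of maximal size: a hook along the top row together with a zigzag path ending in the
last column. -/
theorem exists_isP2Support_card {m n ρ ξ : ℕ}
    (hm : 2 ≤ m) (hn : 2 ≤ n) (hρ1 : 1 ≤ ρ) (hρm : ρ ≤ m) (hξ1 : 1 ≤ ξ) (hξn : ξ ≤ n) :
    ∃ F : Finset (Fin m × Fin n), IsP2Support ρ ξ F ∧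
      (if ξ = 1 ∧ ρ = m then 2 * m + 2 * n - 4 else m + 2 * n + ρ - ξ - 2) ≤ #F := by
  classical
  obtain ⟨x, hx1, hxm, hxρ, hx⟩ : ∃ x, 1 ≤ x ∧ x < m ∧ x ≤ ρ ∧ (x = ρ ∨ ρ = m ∧ x + 1 = m) := by
    rcases hρm.eq_or_lt with h | h
    · exact ⟨m - 1, by omega, by omega, by omega, .inr ⟨h, by omega⟩⟩
    · exact ⟨ρ, hρ1, h, le_rfl, .inl rfl⟩
  let P : Fin m × Fin n → Prop := fun a =>
    (a.2.1 = 0 ∧ a.1.1 < ρ) ∨ (a.1.1 = 0 ∧ a.2.1 + 1 < n)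
  let Q : Fin m × Fin n → Prop := fun a =>
    (a.2.1 + 1 = ξ ∧ x ≤ a.1.1) ∨ (a.1.1 = x ∧ ξ ≤ a.2.1 + 1) ∨ (a.2.1 + 1 = n ∧ a.1.1 ≤ x)
  refine ⟨univ.filter fun a => P a ∨ Q a, ⟨?_, ?_, ?_, ?_⟩, ?_⟩
  · intro a ha
    simp only [mem_filter, mem_univ, true_and, P, Q] at ha
    omega
  · intro a ha b hb c hc
    simp only [mem_filter, mem_univ, true_and, P, Q, Fin.lt_def] at *
    omega
  · intro a ha b hb
    simp only [mem_filter, mem_univ, true_and, P, Q, Fin.lt_def] at *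
    omega
  · intro a ha b hb
    simp only [mem_filter, mem_univ, true_and, P, Q, Fin.lt_def] at *
    omega
  · have hP : (n - 2 + 1 - (1 - ρ) : ℤ).toNat ≤ #(univ.filter P) := by
      rw [← Int.card_Icc]
      refine Finset.card_le_card_of_surjOn (fun a => (a.2 : ℤ) - (a.1 : ℤ)) fun d hd => ?_
      rw [mem_coe, mem_Icc] at hd
      rcases le_total d 0 with h | h
      · refine ⟨(⟨(-d).toNat, by omega⟩, ⟨0, by omega⟩), ?_, by simp only; omega⟩
        simp only [coe_filter, mem_univ, true_and, Set.mem_ofPred_eq, P]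
        omega
      · refine ⟨(⟨0, by omega⟩, ⟨d.toNat, by omega⟩), ?_, by simp only; omega⟩
        simp only [coe_filter, mem_univ, true_and, Set.mem_ofPred_eq, P]
        omega
    have hQ : (n - 1 + 1 - (ξ - m) : ℤ).toNat ≤ #(univ.filter Q) := by
      rw [← Int.card_Icc]
      refine Finset.card_le_card_of_surjOn (fun a => (a.2 : ℤ) - (a.1 : ℤ)) fun d hd => ?_
      rw [mem_coe, mem_Icc] at hd
      rcases le_total d (ξ - 1 - x) with h | h
      · refine ⟨(⟨(ξ - 1 - d).toNat, by omega⟩, ⟨ξ - 1, by omega⟩), ?_, by simp only; omega⟩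
        simp only [coe_filter, mem_univ, true_and, Set.mem_ofPred_eq, Q]
        omega
      · rcases le_total d (n - 1 - x) with h' | h'
        · refine ⟨(⟨x, by omega⟩, ⟨(d + x).toNat, by omega⟩), ?_, by simp only; omega⟩
          simp only [coe_filter, mem_univ, true_and, Set.mem_ofPred_eq, Q]
          omega
        · refine ⟨(⟨(n - 1 - d).toNat, by omega⟩, ⟨n - 1, by omega⟩), ?_, by simp only; omega⟩
          simp only [coe_filter, mem_univ, true_and, Set.mem_ofPred_eq, Q]
          omega
    have hPQ : #(univ.filter P ∩ univ.filter Q) ≤ if ξ = 1 ∧ ρ = m then 1 else 0 := by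
      split_ifs with h
      · rw [Finset.card_le_one]
        intro a ha b hb
        simp only [mem_inter, mem_filter, mem_univ, true_and, P, Q] at ha hb
        ext <;> omega
      · rw [Nat.le_zero, Finset.card_eq_zero, Finset.eq_empty_iff_forall_notMem]
        intro a ha
        simp only [mem_inter, mem_filter, mem_univ, true_and, P, Q] at ha
        omega
    have hunion := Finset.card_union_add_card_inter (univ.filter P) (univ.filter Q)
    rw [Finset.filter_or]
    split_ifs at hPQ ⊢ <;> omega

/-- Corollary 2.2 of the paper: `P2 m n ρ ξ ·` is eventually a polynomial in `r`, of degree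
`2m+2n-5` if `ξ = 1` and `ρ = m`, and of degree `m+2n+ρ-ξ-3` if `ξ > 1` or `ρ < m`. -/
theorem P2_degree (m n ρ ξ : ℕ) (hm : 2 ≤ m) (hn : 2 ≤ n)
    (hρ1 : 1 ≤ ρ) (hρm : ρ ≤ m) (hξ1 : 1 ≤ ξ) (hξn : ξ ≤ n) :
    ∃ p : Polynomial ℚ,
      (∀ᶠ r in Filter.atTop, (P2 m n ρ ξ r : ℚ) = p.eval (r : ℚ)) ∧
      p.natDegree =
        (if ξ = 1 ∧ ρ = m then 2 * m + 2 * n - 5 else m + 2 * n + ρ - ξ - 3) := by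
  classical
  have hpos : (if ξ = 1 ∧ ρ = m then 2 * m + 2 * n - 5 else m + 2 * n + ρ - ξ - 3) + 1 =
      if ξ = 1 ∧ ρ = m then 2 * m + 2 * n - 4 else m + 2 * n + ρ - ξ - 2 := by
    split_ifs <;> omega
  have hle : ∀ F : Finset (Fin m × Fin n), IsP2Support ρ ξ F → F.card ≤ _ :=
    fun F hF => (hF.card_le hm hn hρ1 hξ1 hξn).trans_eq hpos.symm
  obtain ⟨F, hF, hcard⟩ := exists_isP2Support_card hm hn hρ1 hρm hξ1 hξn
  obtain ⟨p, hp, hdeg⟩ := exists_polynomial_card_sym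
    (Finset.univ.filter fun F : Finset (Fin m × Fin n) => IsP2Support ρ ξ F) _
    (fun F hF => hle F (Finset.mem_filter.1 hF).2)
    ⟨F, Finset.mem_filter.2 ⟨Finset.mem_univ _, hF⟩,
      (hle F hF).antisymm (hpos.trans_le hcard)⟩
  refine ⟨p, ?_, hdeg⟩
  filter_upwards [hp] with r hr
  rw [← hr, P2_eq_card]
end

section
/- (Proposition 2.1, closed form of the generating function of P_2.) Let m, n ≥ 2 be integers, 1 ≤ ρ ≤ m, 1 ≤ ξ ≤ n. Then in the ring of formal power series ℚ⟦t⟧ one has (1−t)^{m+2n+ρ−ξ−2} · Σ_{r≥0} P_2(m,n,ρ,ξ,r) t^r = (Σ_{r≥0} C(m−2,r)C(n−ξ,r) t^r)·(Σ_{r≥0} C(ρ−1,r)C(n−1,r) t^r) − (Σ_{r≥1} C(m−2,r−1)C(n−ξ+1,r) t^r)·(Σ_{r≥0} C(ρ−1,r+1)C(n−2,r) t^r). -/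
open PowerSeries

/-! ### The power series counting pairs of weakly monotone sequences -/

/-- Generating function of pairs of multisets of equal size on `p` and `q` letters. -/
noncomputable def seqPairs (p q : ℕ) : PowerSeries ℚ :=
  PowerSeries.mk fun a => (Nat.multichoose p a * Nat.multichoose q a : ℚ)

/-- Generating function of pairs of multisets on `p` and `q` letters, the first one having one
more element than the second. -/
noncomputable def seqPairsSucc (p q : ℕ) : PowerSeries ℚ :=
  PowerSeries.mk fun a => (Nat.multichoose p (a + 1) * Nat.multichoose q a : ℚ)

lemma seqPairs_zero_left (q : ℕ) : seqPairs 0 q = 1 := by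
  ext a
  cases a <;> simp [seqPairs, PowerSeries.coeff_one]

lemma seqPairs_zero_right (p : ℕ) : seqPairs p 0 = 1 := by
  ext a
  cases a <;> simp [seqPairs, PowerSeries.coeff_one]

lemma seqPairs_comm (p q : ℕ) : seqPairs p q = seqPairs q p := by
  ext a
  simp [seqPairs, mul_comm]

lemma seqPairsSucc_zero_left (q : ℕ) : seqPairsSucc 0 q = 0 := by
  ext a
  simp [seqPairsSucc]

lemma seqPairs_succ_right (p q : ℕ) :
    seqPairs p (q + 1) = seqPairs p q + X * seqPairsSucc p (q + 1) := by
  ext a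
  cases a with
  | zero => simp [seqPairs]
  | succ a =>
    simp only [seqPairs, seqPairsSucc, map_add, coeff_mk, coeff_succ_X_mul,
      Nat.multichoose_succ_succ]
    push_cast
    ring

lemma seqPairsSucc_succ_left (p q : ℕ) :
    seqPairsSucc (p + 1) q = seqPairsSucc p q + seqPairs (p + 1) q := by
  ext a
  simp only [seqPairs, seqPairsSucc, map_add, coeff_mk, Nat.multichoose_succ_succ]
  push_cast
  ring

lemma one_sub_X_mul_seqPairs (p q : ℕ) :
    (1 - X) * seqPairs (p + 1) (q + 1) =
      seqPairs p (q + 1) + seqPairs (p + 1) q - seqPairs p q := by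
  linear_combination seqPairs_succ_right (p + 1) q - seqPairs_succ_right p q +
    (X : PowerSeries ℚ) * seqPairsSucc_succ_left p (q + 1)

lemma one_sub_X_mul_seqPairsSucc (p q : ℕ) :
    (1 - X) * seqPairsSucc (p + 1) (q + 1) =
      seqPairsSucc p (q + 1) + seqPairsSucc (p + 1) q - seqPairsSucc p q := by
  linear_combination seqPairsSucc_succ_left p (q + 1) - seqPairsSucc_succ_left p q +
    seqPairs_succ_right (p + 1) q

lemma one_sub_X_pow_mul_seqPairs_one (q : ℕ) :
    (1 - X) ^ q * seqPairs 1 q = 1 := by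
  induction q with
  | zero => simp [seqPairs_zero_right]
  | succ q ih =>
    have h := one_sub_X_mul_seqPairs 0 q
    rw [seqPairs_zero_left, seqPairs_zero_left, zero_add] at h
    linear_combination (1 - X) ^ q * h + ih

/-- Narayana-type polynomials satisfy the same recursion as `seqPairs`, up to powers of `1 - X`. -/
lemma mk_choose_mul_choose_succ_succ (p q : ℕ) :
    (PowerSeries.mk fun r => (((p + 1).choose r * (q + 1).choose r : ℕ) : ℚ)) =
      (PowerSeries.mk fun r => ((p.choose r * (q + 1).choose r : ℕ) : ℚ)) +
      (PowerSeries.mk fun r => (((p + 1).choose r * q.choose r : ℕ) : ℚ)) -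
      (1 - X) * PowerSeries.mk fun r => ((p.choose r * q.choose r : ℕ) : ℚ) := by
  ext r
  cases r with
  | zero => simp [sub_mul]
  | succ r =>
    simp only [sub_mul, one_mul, map_add, map_sub, coeff_mk, coeff_succ_X_mul,
      Nat.choose_succ_succ]
    push_cast
    ring

lemma mk_choose_zero_mul (q : ℕ) :
    (PowerSeries.mk fun r => ((Nat.choose 0 r * q.choose r : ℕ) : ℚ)) = 1 := by
  ext r
  cases r <;> simp [PowerSeries.coeff_one]

lemma mk_choose_mul_zero (p : ℕ) :
    (PowerSeries.mk fun r => ((p.choose r * Nat.choose 0 r : ℕ) : ℚ)) = 1 := by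
  ext r
  cases r <;> simp [PowerSeries.coeff_one]

lemma one_sub_X_pow_mul_seqPairs (p q : ℕ) :
    (1 - X) ^ (p + q + 1) * seqPairs (p + 1) (q + 1) =
      PowerSeries.mk fun r => ((p.choose r * q.choose r : ℕ) : ℚ) := by
  induction p generalizing q with
  | zero => rw [mk_choose_zero_mul, zero_add, zero_add, one_sub_X_pow_mul_seqPairs_one]
  | succ p ihp =>
    induction q with
    | zero =>
      rw [mk_choose_mul_zero, zero_add, add_zero, seqPairs_comm, one_sub_X_pow_mul_seqPairs_one]
    | succ q ihq =>
      rw [mk_choose_mul_choose_succ_succ, ← ihp, ← ihp, ← ihq]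
      linear_combination (1 - X) ^ (p + q + 2) * one_sub_X_mul_seqPairs (p + 1) (q + 1)

lemma one_sub_X_pow_mul_seqPairsSucc (p q : ℕ) :
    (1 - X) ^ (p + q + 1) * seqPairsSucc p (q + 2) =
      PowerSeries.mk fun r => ((p.choose (r + 1) * q.choose r : ℕ) : ℚ) := by
  induction p with
  | zero => ext; simp [seqPairsSucc_zero_left]
  | succ p ih =>
    have h : (PowerSeries.mk fun r => (((p + 1).choose (r + 1) * q.choose r : ℕ) : ℚ)) =
        (1 - X) * (PowerSeries.mk fun r => ((p.choose (r + 1) * q.choose r : ℕ) : ℚ)) +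
        PowerSeries.mk fun r => ((p.choose r * (q + 1).choose r : ℕ) : ℚ) := by
      ext r
      cases r with
      | zero => simp [sub_mul]
      | succ r =>
        simp only [sub_mul, one_mul, map_add, map_sub, coeff_mk, coeff_succ_X_mul,
          Nat.choose_succ_succ]
        push_cast
        ring
    rw [h, ← ih, ← one_sub_X_pow_mul_seqPairs]
    linear_combination (1 - X) ^ (p + q + 2) * seqPairsSucc_succ_left p (q + 2)

/-! ### Generating functions of graded sets -/

/-- The generating function of the pairs of multisets in `S`, by total cardinality. -/
noncomputable def pairGenFun (S : Set (Multiset (ℕ × ℕ) × Multiset (ℕ × ℕ))) : PowerSeries ℚ :=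
  PowerSeries.mk fun r => ({a ∈ S | a.1.card + a.2.card = r}.ncard : ℚ)

/-- Finitely many pairs of each total cardinality. -/
def GradedFinite (S : Set (Multiset (ℕ × ℕ) × Multiset (ℕ × ℕ))) : Prop :=
  ∀ r, {a ∈ S | a.1.card + a.2.card = r}.Finite

lemma GradedFinite.mono {S T : Set (Multiset (ℕ × ℕ) × Multiset (ℕ × ℕ))}
    (hT : GradedFinite T) (h : S ⊆ T) : GradedFinite S :=
  fun r => (hT r).subset fun _ ha => ⟨h ha.1, ha.2⟩

lemma pairGenFun_union_add_inter {S T : Set (Multiset (ℕ × ℕ) × Multiset (ℕ × ℕ))}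
    (hS : GradedFinite S) (hT : GradedFinite T) :
    pairGenFun (S ∪ T) + pairGenFun (S ∩ T) = pairGenFun S + pairGenFun T := by
  ext r
  simp only [pairGenFun, map_add, coeff_mk]
  have h1 : {a ∈ S ∪ T | a.1.card + a.2.card = r} =
      {a ∈ S | a.1.card + a.2.card = r} ∪ {a ∈ T | a.1.card + a.2.card = r} := by
    ext a; exact or_and_right
  have h2 : {a ∈ S ∩ T | a.1.card + a.2.card = r} =
      {a ∈ S | a.1.card + a.2.card = r} ∩ {a ∈ T | a.1.card + a.2.card = r} := by
    ext a; exact and_and_right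
  rw [h1, h2]
  exact_mod_cast Set.ncard_union_add_ncard_inter _ _ (hS r) (hT r)

lemma pairGenFun_empty : pairGenFun ∅ = 0 := by
  ext r
  simp [pairGenFun]

lemma pairGenFun_image {S : Set (Multiset (ℕ × ℕ) × Multiset (ℕ × ℕ))}
    {g : Multiset (ℕ × ℕ) × Multiset (ℕ × ℕ) → Multiset (ℕ × ℕ) × Multiset (ℕ × ℕ)}
    (hg : Function.Injective g)
    (hdeg : ∀ a, (g a).1.card + (g a).2.card = a.1.card + a.2.card + 1) :
    pairGenFun (g '' S) = X * pairGenFun S := by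
  ext r
  cases r with
  | zero =>
    simp only [pairGenFun, coeff_mk, coeff_zero_X_mul]
    have : {a ∈ g '' S | a.1.card + a.2.card = 0} = ∅ := by
      ext a
      simp only [Set.mem_ofPred_eq, Set.mem_empty_iff_false, iff_false, not_and]
      rintro ⟨b, -, rfl⟩
      rw [hdeg]
      omega
    rw [this]
    simp
  | succ r =>
    simp only [pairGenFun, coeff_mk, coeff_succ_X_mul]
    have : {a ∈ g '' S | a.1.card + a.2.card = r + 1} =
        g '' {a ∈ S | a.1.card + a.2.card = r} := by
      ext a
      constructor
      · rintro ⟨⟨b, hb, rfl⟩, h⟩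
        exact ⟨b, ⟨hb, by rw [hdeg] at h; simpa using h⟩, rfl⟩
      · rintro ⟨b, ⟨hb, h⟩, rfl⟩
        exact ⟨⟨b, hb, rfl⟩, by rw [hdeg, h]⟩
    rw [this, Set.ncard_image_of_injective _ hg]

lemma pairGenFun_corner {S P Q : Set (Multiset (ℕ × ℕ) × Multiset (ℕ × ℕ))}
    {g : Multiset (ℕ × ℕ) × Multiset (ℕ × ℕ) → Multiset (ℕ × ℕ) × Multiset (ℕ × ℕ)}
    (hS : GradedFinite S) (hg : Function.Injective g)
    (hdeg : ∀ a, (g a).1.card + (g a).2.card = a.1.card + a.2.card + 1)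
    (hunion : S = g '' S ∪ (P ∪ Q)) (hdisj : Disjoint (g '' S) (P ∪ Q)) :
    (1 - X) * pairGenFun S = pairGenFun P + pairGenFun Q - pairGenFun (P ∩ Q) := by
  have hgS : GradedFinite (g '' S) :=
    hS.mono (Set.subset_union_left.trans_eq hunion.symm)
  have hPQ : GradedFinite (P ∪ Q) :=
    hS.mono (Set.subset_union_right.trans_eq hunion.symm)
  have h1 := pairGenFun_union_add_inter hgS hPQ
  rw [← hunion, hdisj.inter_eq, pairGenFun_empty, pairGenFun_image hg hdeg] at h1
  have h2 := pairGenFun_union_add_inter (hPQ.mono Set.subset_union_left)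
    (hPQ.mono Set.subset_union_right)
  linear_combination h1 + h2

/-! ### Antichains in a box and compatible pairs of antichains -/

lemma Has2Chain.mono {S T : Multiset (ℕ × ℕ)} (h : S ⊆ T) (hS : Has2Chain S) : Has2Chain T := by
  obtain ⟨a, ha, b, hb, hab⟩ := hS
  exact ⟨a, h ha, b, h hb, hab⟩

/-- Multisets without 2-chain supported on rows `l, …, p` and columns `x, …, n`. -/
def boxAntichains (n l p x : ℕ) : Set (Multiset (ℕ × ℕ)) :=
  {A | ¬ Has2Chain A ∧ ∀ a ∈ A, l ≤ a.1 ∧ a.1 ≤ p ∧ x ≤ a.2 ∧ a.2 ≤ n}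

lemma boxAntichains_mono {n l p q x y : ℕ} (hpq : p ≤ q) (hyx : y ≤ x) :
    boxAntichains n l p x ⊆ boxAntichains n l q y := by
  rintro A ⟨h, hA⟩
  refine ⟨h, fun a ha => ?_⟩
  have := hA a ha
  omega

lemma boxAntichains_inter (n l p x : ℕ) :
    boxAntichains n l p x ∩ boxAntichains n l (p + 1) (x + 1) = boxAntichains n l p (x + 1) := by
  ext A
  constructor
  · rintro ⟨⟨h, h1⟩, -, h2⟩
    refine ⟨h, fun a ha => ?_⟩
    have := h1 a ha
    have := h2 a ha
    omega
  · exact fun h => ⟨boxAntichains_mono le_rfl (by omega) h, boxAntichains_mono (by omega) le_rfl h⟩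

lemma cons_corner_mem_boxAntichains {n l p x : ℕ} {A : Multiset (ℕ × ℕ)}
    (hA : A ∈ boxAntichains n l p x) (hl : l ≤ p) (hx : x ≤ n) :
    (p, x) ::ₘ A ∈ boxAntichains n l p x := by
  obtain ⟨h, hA⟩ := hA
  refine ⟨?_, ?_⟩
  · rintro ⟨a, ha, b, hb, h1, h2⟩
    rw [Multiset.mem_cons] at ha hb
    rcases ha with rfl | ha <;> rcases hb with rfl | hb
    · simp at h1
    · have := hA b hb
      simp only at h1
      omega
    · have := hA a ha
      simp only at h2
      omega
    · exact h ⟨a, ha, b, hb, h1, h2⟩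
  · intro a ha
    rw [Multiset.mem_cons] at ha
    rcases ha with rfl | ha
    · exact ⟨hl, le_rfl, le_rfl, hx⟩
    · exact hA a ha

lemma mem_boxAntichains_of_cons {n l p x : ℕ} {A : Multiset (ℕ × ℕ)} {c : ℕ × ℕ}
    (hA : c ::ₘ A ∈ boxAntichains n l p x) : A ∈ boxAntichains n l p x :=
  ⟨fun h => hA.1 (h.mono (Multiset.subset_cons _ _)),
    fun a ha => hA.2 a (Multiset.mem_cons_of_mem ha)⟩

lemma boxAntichains_of_corner_notMem {n l p x : ℕ} {A : Multiset (ℕ × ℕ)}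
    (hA : A ∈ boxAntichains n l (p + 1) x) (hc : (p + 1, x) ∉ A) :
    A ∈ boxAntichains n l p x ∨ A ∈ boxAntichains n l (p + 1) (x + 1) := by
  obtain ⟨h, hA⟩ := hA
  by_contra! hcon
  obtain ⟨h1, h2⟩ := hcon
  have h1 : ∃ a ∈ A, a.1 = p + 1 := by
    by_contra! h'
    refine h1 ⟨h, fun a ha => ?_⟩
    have := hA a ha
    have := h' a ha
    omega
  have h2 : ∃ a ∈ A, a.2 = x := by
    by_contra! h'
    refine h2 ⟨h, fun a ha => ?_⟩
    have := hA a ha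
    have := h' a ha
    omega
  obtain ⟨⟨i, j⟩, ha, rfl : i = p + 1⟩ := h1
  obtain ⟨⟨i', j'⟩, hb, rfl : j' = x⟩ := h2
  have ha' := hA _ ha
  have hb' := hA _ hb
  simp only at ha' hb'
  have hi : i' ≠ p + 1 := by rintro rfl; exact hc hb
  have hj : j ≠ j' := by rintro rfl; exact hc ha
  exact h ⟨_, hb, _, ha, by simp only; omega, by simp only; omega⟩

lemma corner_notMem_of_row {n l p x y : ℕ} {A : Multiset (ℕ × ℕ)}
    (hA : A ∈ boxAntichains n l p x) : (p + 1, y) ∉ A := fun h => by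
  have := hA.2 _ h
  simp only at this
  omega

lemma corner_notMem_of_col {n l p q x : ℕ} {A : Multiset (ℕ × ℕ)}
    (hA : A ∈ boxAntichains n l p (x + 1)) : (q, x) ∉ A := fun h => by
  have := hA.2 _ h
  simp only at this
  omega

lemma boxAntichains_eq_singleton {n l p x : ℕ} (h : p < l ∨ n < x) :
    boxAntichains n l p x = {0} := by
  ext A
  constructor
  · rintro ⟨-, hA⟩
    refine Multiset.eq_zero_of_forall_notMem fun a ha => ?_
    have := hA a ha
    omega
  · rintro rfl
    exact ⟨by simp [Has2Chain], by simp⟩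

/-- Pairs `(A, B)` with `A ∈ 𝒜` and `B` an antichain in rows `2, …, m` and columns `y, …, n` such
that each element of `B` in a row `≤ σ` has an element of `A` strictly to its north-west. -/
def compatiblePairs (𝒜 : Set (Multiset (ℕ × ℕ))) (n m y σ : ℕ) :
    Set (Multiset (ℕ × ℕ) × Multiset (ℕ × ℕ)) :=
  {P | P.1 ∈ 𝒜 ∧ P.2 ∈ boxAntichains n 2 m y ∧
    ∀ b ∈ P.2, b.1 ≤ σ → ∃ a ∈ P.1, a.1 < b.1 ∧ a.2 < b.2}

lemma finite_multisets_in_box (p n r : ℕ) :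
    {A : Multiset (ℕ × ℕ) | (∀ a ∈ A, a.1 ≤ p ∧ a.2 ≤ n) ∧ A.card ≤ r}.Finite := by
  refine (Set.finite_Iic (r • (Finset.range (p + 1) ×ˢ Finset.range (n + 1)).val)).subset ?_
  rintro A ⟨hA, hr⟩
  rw [Set.mem_Iic, Multiset.le_iff_count]
  intro a
  by_cases ha : a ∈ A
  · have h := hA a ha
    have hmem : a ∈ Finset.range (p + 1) ×ˢ Finset.range (n + 1) := by
      simp only [Finset.mem_product, Finset.mem_range]
      omega
    rw [Multiset.count_nsmul, Multiset.count_eq_one_of_mem (Finset.nodup _) hmem, mul_one]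
    exact (Multiset.count_le_card _ _).trans hr
  · rw [Multiset.count_eq_zero_of_notMem ha]
    exact Nat.zero_le _

lemma gradedFinite_compatiblePairs {𝒜 : Set (Multiset (ℕ × ℕ))} {n l p x m y σ : ℕ}
    (h𝒜 : 𝒜 ⊆ boxAntichains n l p x) : GradedFinite (compatiblePairs 𝒜 n m y σ) := by
  intro r
  refine ((finite_multisets_in_box p n r).prod (finite_multisets_in_box m n r)).subset ?_
  rintro ⟨A, B⟩ ⟨⟨hA, hB, -⟩, hr⟩
  simp only at hr hA hB
  refine ⟨⟨fun a ha => ?_, by simp only; omega⟩, ⟨fun b hb => ?_, by simp only; omega⟩⟩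
  · have := (h𝒜 hA).2 a ha
    omega
  · have := hB.2 b hb
    omega

lemma pairGenFun_compatiblePairs_diff {𝒜 ℬ : Set (Multiset (ℕ × ℕ))} {n l p x m y σ : ℕ}
    (h𝒜 : 𝒜 ⊆ boxAntichains n l p x) (hℬ : ℬ ⊆ 𝒜) :
    pairGenFun (compatiblePairs (𝒜 \ ℬ) n m y σ) =
      pairGenFun (compatiblePairs 𝒜 n m y σ) - pairGenFun (compatiblePairs ℬ n m y σ) := by
  have h := pairGenFun_union_add_inter
    (gradedFinite_compatiblePairs (m := m) (y := y) (σ := σ) (Set.sdiff_subset.trans h𝒜 : 𝒜 \ ℬ ⊆ _))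
    (gradedFinite_compatiblePairs (m := m) (y := y) (σ := σ) (hℬ.trans h𝒜))
  have h1 : compatiblePairs (𝒜 \ ℬ) n m y σ ∪ compatiblePairs ℬ n m y σ =
      compatiblePairs 𝒜 n m y σ := by
    ext P
    have := @hℬ P.1
    simp only [compatiblePairs, Set.mem_union, Set.mem_ofPred_eq, Set.mem_sdiff]
    tauto
  have h2 : compatiblePairs (𝒜 \ ℬ) n m y σ ∩ compatiblePairs ℬ n m y σ = ∅ := by
    ext P
    simp only [compatiblePairs, Set.mem_inter_iff, Set.mem_ofPred_eq, Set.mem_sdiff,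
      Set.mem_empty_iff_false]
    tauto
  rw [h1, h2, pairGenFun_empty] at h
  linear_combination -h

lemma pairGenFun_corner_fst {n p x m y σ : ℕ} (hσ : σ ≤ p + 1) (hx : x ≤ n) :
    (1 - X) * pairGenFun (compatiblePairs (boxAntichains n 1 (p + 1) x) n m y σ) =
      pairGenFun (compatiblePairs (boxAntichains n 1 p x) n m y σ) +
      pairGenFun (compatiblePairs (boxAntichains n 1 (p + 1) (x + 1)) n m y σ) -
      pairGenFun (compatiblePairs (boxAntichains n 1 p (x + 1)) n m y σ) := by
  have hinter : compatiblePairs (boxAntichains n 1 p x) n m y σ ∩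
      compatiblePairs (boxAntichains n 1 (p + 1) (x + 1)) n m y σ =
      compatiblePairs (boxAntichains n 1 p (x + 1)) n m y σ := by
    rw [← boxAntichains_inter n 1 p x]
    ext P
    simp only [compatiblePairs, Set.mem_inter_iff, Set.mem_ofPred_eq]
    tauto
  rw [← hinter]
  refine pairGenFun_corner (g := fun P => ((p + 1, x) ::ₘ P.1, P.2))
    (gradedFinite_compatiblePairs subset_rfl) ?_ ?_ ?_ ?_
  · rintro ⟨A, B⟩ ⟨A', B'⟩ h
    simpa using h
  · rintro ⟨A, B⟩
    simp only [Multiset.card_cons]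
    omega
  · ext ⟨A, B⟩
    constructor
    · rintro ⟨hA, hB, h⟩
      simp only at hA hB h
      by_cases hc : (p + 1, x) ∈ A
      · obtain ⟨A, rfl⟩ := Multiset.exists_cons_of_mem hc
        refine Or.inl ⟨(A, B), ⟨mem_boxAntichains_of_cons hA, hB, fun b hb hbσ => ?_⟩, rfl⟩
        obtain ⟨a, ha, h1, h2⟩ := h b hb hbσ
        refine ⟨a, ?_, h1, h2⟩
        rcases Multiset.mem_cons.1 ha with rfl | ha
        · simp only at h1
          omega
        · exact ha
      · exact Or.inr ((boxAntichains_of_corner_notMem hA hc).imp (fun h' => ⟨h', hB, h⟩)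
          fun h' => ⟨h', hB, h⟩)
    · rintro (⟨⟨A, B⟩, ⟨hA, hB, h⟩, heq⟩ | ⟨hA, hB, h⟩ | ⟨hA, hB, h⟩)
      · rw [← heq]
        refine ⟨cons_corner_mem_boxAntichains hA (by omega) hx, hB, fun b hb hbσ => ?_⟩
        obtain ⟨a, ha, h'⟩ := h b hb hbσ
        exact ⟨a, Multiset.mem_cons_of_mem ha, h'⟩
      · exact ⟨boxAntichains_mono (by omega) le_rfl hA, hB, h⟩
      · exact ⟨boxAntichains_mono le_rfl (by omega) hA, hB, h⟩
  · rw [Set.disjoint_left]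
    rintro _ ⟨⟨A, B⟩, -, rfl⟩ (⟨hA, -⟩ | ⟨hA, -⟩)
    · exact corner_notMem_of_row hA (Multiset.mem_cons_self _ _)
    · exact corner_notMem_of_col hA (Multiset.mem_cons_self _ _)

lemma pairGenFun_corner_snd {𝒜 : Set (Multiset (ℕ × ℕ))} {n l p x m y σ : ℕ}
    (h𝒜 : 𝒜 ⊆ boxAntichains n l p x) (hm : 1 ≤ m) (hy : y ≤ n)
    (hcorner : ∀ A ∈ 𝒜, m + 1 ≤ σ → ∃ a ∈ A, a.1 < m + 1 ∧ a.2 < y) :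
    (1 - X) * pairGenFun (compatiblePairs 𝒜 n (m + 1) y σ) =
      pairGenFun (compatiblePairs 𝒜 n m y σ) +
      pairGenFun (compatiblePairs 𝒜 n (m + 1) (y + 1) σ) -
      pairGenFun (compatiblePairs 𝒜 n m (y + 1) σ) := by
  have hinter : compatiblePairs 𝒜 n m y σ ∩ compatiblePairs 𝒜 n (m + 1) (y + 1) σ =
      compatiblePairs 𝒜 n m (y + 1) σ := by
    ext P
    simp only [compatiblePairs, ← boxAntichains_inter n 2 m y, Set.mem_inter_iff,
      Set.mem_ofPred_eq]
    tauto
  rw [← hinter]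
  refine pairGenFun_corner (g := fun P => (P.1, (m + 1, y) ::ₘ P.2))
    (gradedFinite_compatiblePairs h𝒜) ?_ ?_ ?_ ?_
  · rintro ⟨A, B⟩ ⟨A', B'⟩ h
    simpa using h
  · rintro ⟨A, B⟩
    simp only [Multiset.card_cons]
    omega
  · ext ⟨A, B⟩
    constructor
    · rintro ⟨hA, hB, h⟩
      simp only at hA hB h
      by_cases hc : (m + 1, y) ∈ B
      · obtain ⟨B, rfl⟩ := Multiset.exists_cons_of_mem hc
        exact Or.inl ⟨(A, B), ⟨hA, mem_boxAntichains_of_cons hB,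
          fun b hb => h b (Multiset.mem_cons_of_mem hb)⟩, rfl⟩
      · exact Or.inr ((boxAntichains_of_corner_notMem hB hc).imp (fun h' => ⟨hA, h', h⟩)
          fun h' => ⟨hA, h', h⟩)
    · rintro (⟨⟨A, B⟩, ⟨hA, hB, h⟩, heq⟩ | ⟨hA, hB, h⟩ | ⟨hA, hB, h⟩)
      · rw [← heq]
        refine ⟨hA, cons_corner_mem_boxAntichains hB (by omega) hy, fun b hb hbσ => ?_⟩
        rcases Multiset.mem_cons.1 hb with rfl | hb
        · exact hcorner A hA hbσ
        · exact h b hb hbσ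
      · exact ⟨hA, boxAntichains_mono (by omega) le_rfl hB, h⟩
      · exact ⟨hA, boxAntichains_mono le_rfl (by omega) hB, h⟩
  · rw [Set.disjoint_left]
    rintro _ ⟨⟨A, B⟩, -, rfl⟩ (⟨-, hB, -⟩ | ⟨-, hB, -⟩)
    · exact corner_notMem_of_row hB (Multiset.mem_cons_self _ _)
    · exact corner_notMem_of_col hB (Multiset.mem_cons_self _ _)

lemma compatiblePairs_congr_bound (𝒜 : Set (Multiset (ℕ × ℕ))) (n y : ℕ) {m σ τ : ℕ}
    (hσ : m ≤ σ) (hτ : m ≤ τ) : compatiblePairs 𝒜 n m y σ = compatiblePairs 𝒜 n m y τ := by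
  ext P
  refine and_congr_right fun _ => and_congr_right fun hB => forall₂_congr fun b hb => ?_
  have := hB.2 b hb
  simp [show b.1 ≤ σ by omega, show b.1 ≤ τ by omega]

lemma compatiblePairs_eq_prod (𝒜 : Set (Multiset (ℕ × ℕ))) {n m y : ℕ} (σ : ℕ)
    (h : m < 2 ∨ n < y) : compatiblePairs 𝒜 n m y σ = 𝒜 ×ˢ {0} := by
  ext ⟨A, B⟩
  simp only [compatiblePairs, boxAntichains_eq_singleton h, Set.mem_ofPred_eq, Set.mem_prod,
    Set.mem_singleton_iff]
  constructor
  · tauto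
  · rintro ⟨hA, rfl⟩
    exact ⟨hA, rfl, by simp⟩

lemma compatiblePairs_diagonal {n p m y σ : ℕ} (hσ : m ≤ σ) :
    compatiblePairs (boxAntichains n 1 p y) n m y σ =
      compatiblePairs (boxAntichains n 1 p y) n m (y + 1) σ := by
  ext ⟨A, B⟩
  constructor
  · rintro ⟨hA, hB, h⟩
    refine ⟨hA, ⟨hB.1, fun b hb => ?_⟩, h⟩
    have hb' := hB.2 b hb
    obtain ⟨a, ha, h1, h2⟩ := h b hb (by omega)
    have := hA.2 a ha
    omega
  · rintro ⟨hA, hB, h⟩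
    exact ⟨hA, boxAntichains_mono le_rfl (by omega) hB, h⟩

lemma one_sub_X_ne_zero : (1 - X : PowerSeries ℚ) ≠ 0 := fun h => by
  have := congrArg (PowerSeries.coeff 0) h
  simp at this

lemma pairGenFun_boxAntichains_prod (n p : ℕ) {x a : ℕ} (hx : x + a = n + 1) :
    pairGenFun (boxAntichains n 1 p x ×ˢ {0}) = seqPairs p a := by
  have hone : pairGenFun ({0} ×ˢ {0}) = 1 := by
    ext r
    have : {P ∈ ({0} ×ˢ {0} : Set (Multiset (ℕ × ℕ) × Multiset (ℕ × ℕ))) |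
        P.1.card + P.2.card = r} = if r = 0 then {(0, 0)} else ∅ := by
      ext ⟨A, B⟩
      split_ifs with hr
      · subst hr
        simp
      · simp only [Set.mem_ofPred_eq, Set.mem_prod, Set.mem_singleton_iff,
          Set.mem_empty_iff_false, iff_false]
        rintro ⟨⟨rfl, rfl⟩, h⟩
        exact hr (by simpa using h.symm)
    simp only [pairGenFun, coeff_mk, this, PowerSeries.coeff_one]
    split_ifs <;> simp
  induction p generalizing x a with
  | zero => rw [boxAntichains_eq_singleton (by omega), hone, seqPairs_zero_left]
  | succ p ihp =>
    induction a generalizing x with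
    | zero => rw [boxAntichains_eq_singleton (by omega), hone, seqPairs_zero_right]
    | succ a iha =>
      have h := pairGenFun_corner_fst (n := n) (p := p) (x := x) (m := 0) (y := 0) (σ := 0)
        (by omega) (by omega)
      simp only [compatiblePairs_eq_prod _ 0 (show 0 < 2 ∨ n < 0 from Or.inl two_pos)] at h
      have hx' : x + 1 + a = n + 1 := by omega
      rw [ihp hx, ihp hx', iha hx', ← one_sub_X_mul_seqPairs] at h
      exact mul_left_cancel₀ one_sub_X_ne_zero h

lemma pairGenFun_compatiblePairs_diag (n s : ℕ) {x y a b : ℕ} (hx : x + a = n + 1)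
    (hy : y + b = n + 1) (hxy : x ≤ y) :
    pairGenFun (compatiblePairs (boxAntichains n 1 (s + 1) x) n (s + 1) y (s + 1)) =
      seqPairs s b * seqPairs (s + 1) a - X * seqPairsSucc b (s + 1) * seqPairsSucc s a := by
  induction s generalizing x y a b with
  | zero =>
    rw [compatiblePairs_eq_prod _ _ (by omega), pairGenFun_boxAntichains_prod n _ hx,
      seqPairs_zero_left, seqPairsSucc_zero_left]
    ring
  | succ s ih =>
    have hdiff : ∀ b x y a, x + (a + 1) = n + 1 → y + b = n + 1 → x < y →
        pairGenFun (compatiblePairs (boxAntichains n 1 (s + 1) x) n (s + 2) y (s + 2)) -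
        pairGenFun (compatiblePairs (boxAntichains n 1 (s + 1) (x + 1)) n (s + 2) y (s + 2)) =
        seqPairs (s + 1) b * (seqPairs (s + 1) (a + 1) - seqPairs (s + 1) a) -
        X * seqPairsSucc b (s + 2) * (seqPairsSucc s (a + 1) - seqPairsSucc s a) := by
      intro b
      induction b with
      | zero =>
        intro x y a hx hy hxy
        rw [compatiblePairs_eq_prod _ _ (by omega), compatiblePairs_eq_prod _ _ (by omega),
          pairGenFun_boxAntichains_prod n _ hx,
          pairGenFun_boxAntichains_prod n _ (show x + 1 + a = n + 1 by omega),
          seqPairs_zero_right, seqPairsSucc_zero_left]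
        ring
      | succ b ihb =>
        intro x y a hx hy hxy
        have hsub := boxAntichains_mono (n := n) (l := 1) (le_refl (s + 1)) (Nat.le_succ x)
        have h := pairGenFun_corner_snd (n := n) (m := s + 1) (y := y) (σ := s + 2)
          (𝒜 := boxAntichains n 1 (s + 1) x \ boxAntichains n 1 (s + 1) (x + 1))
          Set.sdiff_subset (by omega) (by omega) (by
            rintro A ⟨hA, hA'⟩ -
            by_contra! hcon
            refine hA' ⟨hA.1, fun c hc => ?_⟩
            have h1 := hA.2 c hc
            have h2 := hcon c hc (by omega)
            omega)
        simp only [pairGenFun_compatiblePairs_diff subset_rfl hsub,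
          compatiblePairs_congr_bound _ n _ (show s + 1 ≤ s + 2 by omega) (le_refl (s + 1))] at h
        rw [ih hx hy hxy.le, ih (show x + 1 + a = n + 1 by omega) hy hxy,
          ih hx (show y + 1 + b = n + 1 by omega) (by omega),
          ih (show x + 1 + a = n + 1 by omega) (show y + 1 + b = n + 1 by omega) (by omega),
          ihb x (y + 1) a hx (by omega) (by omega)] at h
        refine mul_left_cancel₀ one_sub_X_ne_zero (h.trans ?_)
        linear_combination
          -(seqPairs (s + 1) (a + 1) - seqPairs (s + 1) a) * one_sub_X_mul_seqPairs s b +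
          X * (seqPairsSucc s (a + 1) - seqPairsSucc s a) * one_sub_X_mul_seqPairsSucc b (s + 1)
    induction b generalizing x y a with
    | zero =>
      rw [compatiblePairs_eq_prod _ _ (by omega), pairGenFun_boxAntichains_prod n _ hx,
        seqPairs_zero_right, seqPairsSucc_zero_left]
      ring
    | succ b ihb =>
      obtain ⟨d, rfl⟩ := Nat.exists_eq_add_of_le hxy
      induction d generalizing x a with
      | zero =>
        obtain rfl : a = b + 1 := by omega
        rw [Nat.add_zero x, compatiblePairs_diagonal (Nat.le_refl _),
          ihb hx (show x + 1 + b = n + 1 by omega) (by omega)]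
        linear_combination
          -seqPairs (s + 1 + 1) (b + 1) * seqPairs_succ_right (s + 1) b +
          X * seqPairsSucc (s + 1) (b + 1) * seqPairsSucc_succ_left b (s + 1 + 1) +
          X * seqPairsSucc (s + 1) (b + 1) * seqPairs_comm (b + 1) (s + 1 + 1)
      | succ d ihd =>
        obtain ⟨a, rfl⟩ : ∃ a', a = a' + 1 := ⟨a - 1, by omega⟩
        have h := pairGenFun_corner_fst (n := n) (p := s + 1) (x := x) (m := s + 2)
          (y := x + (d + 1)) (σ := s + 2) le_rfl (by omega)
        have h1 := hdiff (b + 1) x (x + (d + 1)) a hx hy (by omega)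
        have h2 := ihd (x := x + 1) (a := a) (by omega) (by omega) (by omega)
        rw [show x + 1 + d = x + (d + 1) by omega] at h2
        refine mul_left_cancel₀ one_sub_X_ne_zero (h.trans ?_)
        linear_combination h1 + h2 -
          seqPairs (s + 1) (b + 1) * one_sub_X_mul_seqPairs (s + 1) a +
          X * seqPairsSucc (b + 1) (s + 1 + 1) * one_sub_X_mul_seqPairsSucc s a

lemma pairGenFun_compatiblePairs (n s k : ℕ) {x y a b : ℕ} (hx : x + a = n + 1)
    (hy : y + b = n + 1) (hxy : x ≤ y) :
    pairGenFun (compatiblePairs (boxAntichains n 1 (s + 1) x) n (s + k + 1) y (s + 1)) =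
      seqPairs (s + k) b * seqPairs (s + 1) a -
        X * seqPairsSucc b (s + k + 1) * seqPairsSucc s a := by
  induction k generalizing y b with
  | zero => exact pairGenFun_compatiblePairs_diag n s hx hy hxy
  | succ k ihk =>
    induction b generalizing y with
    | zero =>
      rw [compatiblePairs_eq_prod _ _ (by omega), pairGenFun_boxAntichains_prod n _ hx,
        seqPairs_zero_right, seqPairsSucc_zero_left]
      ring
    | succ b ihb =>
      have h := pairGenFun_corner_snd (n := n) (m := s + k + 1) (y := y) (σ := s + 1)
        (𝒜 := boxAntichains n 1 (s + 1) x) subset_rfl (by omega) (by omega)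
        (fun A _ hle => by omega)
      rw [ihk hy hxy, ihk (show y + 1 + b = n + 1 by omega) (by omega)] at h
      have h2 := ihb (y := y + 1) (by omega) (by omega)
      refine mul_left_cancel₀ one_sub_X_ne_zero (h.trans ?_)
      linear_combination h2 - seqPairs (s + 1) a * one_sub_X_mul_seqPairs (s + k) b +
        X * seqPairsSucc s a * one_sub_X_mul_seqPairsSucc b (s + k + 1)

/-! ### Splitting a monomial into two antichains -/

/-- The multisets of pairs counted by `P2`. -/
def IsP2Multiset (m n ρ ξ : ℕ) (S : Multiset (ℕ × ℕ)) : Prop :=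
  (∀ p ∈ S, p.1 ≤ ρ ∨ ξ ≤ p.2) ∧ ¬ Has3Chain S ∧
    ¬ Has2Chain (S.filter (fun p => p.2 < ξ)) ∧ ¬ Has2Chain (S.filter (fun p => ρ < p.1)) ∧
    ∀ p ∈ S, 1 ≤ p.1 ∧ p.1 ≤ m ∧ 1 ≤ p.2 ∧ p.2 ≤ n

lemma P2_eq_ncard (m n ρ ξ r : ℕ) :
    P2 m n ρ ξ r = {S | IsP2Multiset m n ρ ξ S ∧ S.card = r}.ncard := by
  have hinj : Function.Injective (fun p : Fin m × Fin n => (p.1.1 + 1, p.2.1 + 1)) := by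
    rintro ⟨a, b⟩ ⟨c, d⟩ h
    simp only [Prod.mk.injEq, add_left_inj] at h
    exact Prod.ext (Fin.ext h.1) (Fin.ext h.2)
  rw [P2, ← Nat.card_coe_set_eq]
  refine Nat.card_eq_of_bijective
    (fun f => ⟨idxMS m n r f.1, ⟨f.2.1, f.2.2.1, f.2.2.2.1, f.2.2.2.2, ?_⟩, ?_⟩) ⟨?_, ?_⟩
  · intro p hp
    obtain ⟨q, -, rfl⟩ := Multiset.mem_map.1 hp
    have := q.1.2
    have := q.2.2
    simp only
    omega
  · simp [idxMS]
  · rintro ⟨f, hf⟩ ⟨g, hg⟩ h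
    simp only [Subtype.mk.injEq] at h ⊢
    exact Sym.coe_injective (Multiset.map_injective hinj h)
  · rintro ⟨S, ⟨h1, h2, h3, h4, hbox⟩, hcard⟩
    have hS : ∃ T : Multiset (Fin m × Fin n),
        T.map (fun p => (p.1.1 + 1, p.2.1 + 1)) = S := by
      clear h1 h2 h3 h4 hcard
      induction S using Multiset.induction_on with
      | empty => exact ⟨0, rfl⟩
      | cons p S ih =>
        obtain ⟨T, rfl⟩ := ih fun q hq => hbox q (Multiset.mem_cons_of_mem hq)
        have hp := hbox p (Multiset.mem_cons_self _ _)
        refine ⟨(⟨p.1 - 1, by omega⟩, ⟨p.2 - 1, by omega⟩) ::ₘ T, ?_⟩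
        rw [Multiset.map_cons]
        congr 1
        ext <;> simp only <;> omega
    obtain ⟨T, rfl⟩ := hS
    exact ⟨⟨⟨T, by simpa using hcard⟩, h1, h2, h3, h4⟩, rfl⟩

open Classical in
lemma ncard_isP2Multiset (m n ρ ξ r : ℕ) (hρ : 1 ≤ ρ) (hρm : ρ ≤ m) (hξ : 1 ≤ ξ) :
    {S | IsP2Multiset m n ρ ξ S ∧ S.card = r}.ncard =
      {P ∈ compatiblePairs (boxAntichains n 1 ρ 1) n m ξ ρ | P.1.card + P.2.card = r}.ncard := by
  set good : Multiset (ℕ × ℕ) → ℕ × ℕ → Prop := fun S a =>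
    a.1 ≤ ρ ∧ ∀ c ∈ S, c.1 < a.1 → ¬ c.2 < a.2
  have hrec : ∀ P ∈ compatiblePairs (boxAntichains n 1 ρ 1) n m ξ ρ,
      (P.1 + P.2).filter (good (P.1 + P.2)) = P.1 := by
    rintro ⟨A, B⟩ ⟨hA, hB, h⟩
    simp only at hA hB h
    have h1 : A.filter (good (A + B)) = A := by
      refine Multiset.filter_eq_self.2 fun a ha => ⟨(hA.2 a ha).2.1, fun c hc h1 h2 => ?_⟩
      rcases Multiset.mem_add.1 hc with hc | hc
      · exact hA.1 ⟨c, hc, a, ha, h1, h2⟩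
      · obtain ⟨d, hd, h3, h4⟩ := h c hc (by have := hA.2 a ha; omega)
        exact hA.1 ⟨d, hd, a, ha, by omega, by omega⟩
    have h2 : B.filter (good (A + B)) = 0 := by
      refine Multiset.filter_eq_nil.2 fun b hb hg => ?_
      obtain ⟨a, ha, h1, h2⟩ := h b hb hg.1
      exact hg.2 a (Multiset.mem_add.2 (Or.inl ha)) h1 h2
    rw [Multiset.filter_add, h1, h2, add_zero]
  symm
  refine Set.ncard_congr (fun P _ => P.1 + P.2) ?_ ?_ ?_
  · rintro ⟨A, B⟩ ⟨⟨hA, hB, h⟩, hr⟩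
    simp only at hA hB h hr
    refine ⟨⟨?_, ?_, ?_, ?_, ?_⟩, by simpa using hr⟩
    · intro p hp
      rcases Multiset.mem_add.1 hp with hp | hp
      · exact Or.inl (hA.2 p hp).2.1
      · exact Or.inr (hB.2 p hp).2.2.1
    · rintro ⟨a, ha, b, hb, c, hc, h1, h2, h3, h4⟩
      rcases Multiset.mem_add.1 ha with ha | ha <;> rcases Multiset.mem_add.1 hb with hb | hb <;>
        rcases Multiset.mem_add.1 hc with hc | hc
      · exact hA.1 ⟨a, ha, b, hb, h1, h3⟩
      · exact hA.1 ⟨a, ha, b, hb, h1, h3⟩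
      · exact hA.1 ⟨a, ha, c, hc, h1.trans h2, h3.trans h4⟩
      · exact hB.1 ⟨b, hb, c, hc, h2, h4⟩
      · exact hA.1 ⟨b, hb, c, hc, h2, h4⟩
      · exact hB.1 ⟨a, ha, c, hc, h1.trans h2, h3.trans h4⟩
      · exact hB.1 ⟨a, ha, b, hb, h1, h3⟩
      · exact hB.1 ⟨a, ha, b, hb, h1, h3⟩
    · rintro hc
      refine hA.1 (hc.mono fun p hp => ?_)
      obtain ⟨hp, hlt⟩ := Multiset.mem_filter.1 hp
      refine (Multiset.mem_add.1 hp).resolve_right fun hp => ?_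
      have := hB.2 p hp
      omega
    · rintro hc
      refine hB.1 (hc.mono fun p hp => ?_)
      obtain ⟨hp, hlt⟩ := Multiset.mem_filter.1 hp
      refine (Multiset.mem_add.1 hp).resolve_left fun hp => ?_
      have := hA.2 p hp
      omega
    · intro p hp
      rcases Multiset.mem_add.1 hp with hp | hp
      · have := hA.2 p hp
        omega
      · have := hB.2 p hp
        omega
  · rintro P Q ⟨hP, -⟩ ⟨hQ, -⟩ h
    have h1 : P.1 = Q.1 := by simpa only [h, hrec Q hQ, eq_comm] using hrec P hP
    rw [h1] at h
    exact Prod.ext h1 (add_left_cancel h)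
  · rintro S ⟨⟨hreg, h3, hcol, hrow, hbox⟩, hr⟩
    have hbelow : ∀ p ∈ S, ¬ good S p → p.1 ≤ ρ → ∃ c ∈ S, c.1 < p.1 ∧ c.2 < p.2 := by
      intro p hp hg hpρ
      by_contra! hcon
      exact hg ⟨hpρ, fun c hc h1 h2 => absurd (hcon c hc h1) (by omega)⟩
    refine ⟨(S.filter (good S), S.filter (fun a => ¬ good S a)), ⟨⟨⟨?_, ?_⟩, ⟨?_, ?_⟩, ?_⟩, ?_⟩,
      Multiset.filter_add_not _ _⟩
    · rintro ⟨a, ha, b, hb, h1, h2⟩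
      exact (Multiset.mem_filter.1 hb).2.2 a (Multiset.mem_filter.1 ha).1 h1 h2
    · intro a ha
      obtain ⟨ha, hg⟩ := Multiset.mem_filter.1 ha
      have := hbox a ha
      exact ⟨this.1, hg.1, this.2.2.1, this.2.2.2⟩
    · rintro ⟨a, ha, b, hb, h1, h2⟩
      obtain ⟨ha, hga⟩ := Multiset.mem_filter.1 ha
      obtain ⟨hb, hgb⟩ := Multiset.mem_filter.1 hb
      by_cases haρ : a.1 ≤ ρ
      · obtain ⟨c, hc, h4, h5⟩ := hbelow a ha hga haρ
        exact h3 ⟨c, hc, a, ha, b, hb, h4, h1, h5, h2⟩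
      · exact hrow ⟨a, Multiset.mem_filter.2 ⟨ha, by omega⟩, b,
          Multiset.mem_filter.2 ⟨hb, by omega⟩, h1, h2⟩
    · intro b hb
      obtain ⟨hb, hg⟩ := Multiset.mem_filter.1 hb
      have hbb := hbox b hb
      have hbr := hreg b hb
      by_cases hbρ : b.1 ≤ ρ
      · obtain ⟨c, hc, h1, h2⟩ := hbelow b hb hg hbρ
        have hcb := hbox c hc
        refine ⟨by omega, hbb.2.1, ?_, hbb.2.2.2⟩
        by_contra! hlt
        exact hcol ⟨c, Multiset.mem_filter.2 ⟨hc, by omega⟩, b,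
          Multiset.mem_filter.2 ⟨hb, hlt⟩, h1, h2⟩
      · omega
    · intro b hb hbρ
      obtain ⟨hb, hg⟩ := Multiset.mem_filter.1 hb
      obtain ⟨c, hc, h1, h2⟩ := hbelow b hb hg hbρ
      refine ⟨c, Multiset.mem_filter.2 ⟨hc, by omega, fun d hd h4 h5 => ?_⟩, h1, h2⟩
      exact h3 ⟨d, hd, c, hc, b, hb, h4, h1, h5, h2⟩
    · simp only
      rw [← Multiset.card_add, Multiset.filter_add_not, hr]

/-- Proposition 2.1 of the paper: closed form of the generating function of `P2` in `ℚ⟦t⟧`. -/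
theorem P2_genFun (m n ρ ξ : ℕ) (hm : 2 ≤ m) (hn : 2 ≤ n)
    (hρ1 : 1 ≤ ρ) (hρm : ρ ≤ m) (hξ1 : 1 ≤ ξ) (hξn : ξ ≤ n) :
    (1 - PowerSeries.X : PowerSeries ℚ) ^ (m + 2 * n + ρ - ξ - 2) *
        PowerSeries.mk (fun r => (P2 m n ρ ξ r : ℚ)) =
      PowerSeries.mk (fun r => ((Nat.choose (m - 2) r * Nat.choose (n - ξ) r : ℕ) : ℚ)) *
        PowerSeries.mk (fun r => ((Nat.choose (ρ - 1) r * Nat.choose (n - 1) r : ℕ) : ℚ)) -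
      PowerSeries.mk (fun r => if r = 0 then 0 else
          ((Nat.choose (m - 2) (r - 1) * Nat.choose (n - ξ + 1) r : ℕ) : ℚ)) *
        PowerSeries.mk (fun r =>
          ((Nat.choose (ρ - 1) (r + 1) * Nat.choose (n - 2) r : ℕ) : ℚ)) := by
  obtain ⟨s, rfl⟩ : ∃ s, ρ = s + 1 := ⟨ρ - 1, by omega⟩
  obtain ⟨k, rfl⟩ : ∃ k, m = s + k + 1 := ⟨m - (s + 1), by omega⟩
  obtain ⟨M, hM⟩ : ∃ M, s + k = M + 1 := ⟨s + k - 1, by omega⟩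
  obtain ⟨N, rfl⟩ : ∃ N, n = N + 2 := ⟨n - 2, by omega⟩
  obtain ⟨b, hb⟩ : ∃ b, ξ + b = N + 2 := ⟨N + 2 - ξ, by omega⟩
  have hgf : PowerSeries.mk (fun r => (P2 (s + k + 1) (N + 2) (s + 1) ξ r : ℚ)) =
      pairGenFun (compatiblePairs (boxAntichains (N + 2) 1 (s + 1) 1) (N + 2) (s + k + 1) ξ
        (s + 1)) := by
    ext r
    simp only [pairGenFun, coeff_mk]
    rw [P2_eq_ncard, ncard_isP2Multiset _ _ _ _ _ hρ1 hρm hξ1]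
  rw [hgf, pairGenFun_compatiblePairs (N + 2) s k (a := N + 2) (b := b + 1) (by omega) (by omega)
    hξ1, hM]
  have h1 := one_sub_X_pow_mul_seqPairs M b
  have h2 := one_sub_X_pow_mul_seqPairs s (N + 1)
  have h3 := one_sub_X_pow_mul_seqPairsSucc (b + 1) M
  have h4 := one_sub_X_pow_mul_seqPairsSucc s N
  have h5 : (PowerSeries.mk fun r => if r = 0 then (0 : ℚ) else
      ((M.choose (r - 1) * (b + 1).choose r : ℕ) : ℚ)) =
      X * PowerSeries.mk fun r => (((b + 1).choose (r + 1) * M.choose r : ℕ) : ℚ) := by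
    ext r
    cases r with
    | zero => simp
    | succ r => simp [coeff_succ_X_mul, mul_comm]
  rw [show M + 1 + 1 - 2 = M by omega, show N + 2 - ξ = b by omega, Nat.add_sub_cancel,
    show N + 2 - 1 = N + 1 by omega, Nat.add_sub_cancel, h5, ← h1, ← h2, ← h3, ← h4,
    show M + 1 + 1 + 2 * (N + 2) + (s + 1) - ξ - 2 = M + b + 1 + (s + (N + 1) + 1) by omega]
  ring
end
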